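/- arXiv:1604.08779 — 2 statements merged into one kernel-verified Lean document; each statement's English description precedes it below -/
import Mathlib

section
/- In the two-dimensional robot game (A,E) constructed from a 2RGS (A1,E1), suppose Eve has played only correct regular moves until Adam plays a state-check Check(i) for the first time. Then Eve has a winning strategy from the resulting position (Eve to move), starting with the state-defence move Move(s_{ab},k) − Check(i), where s_{ab} is the currently encoded 2RGS state and k ∈ {⊤_{ab},⊤'_{ab}} with k ≠ i. -/
/-- A history of a play of a (stateless) robot game: the rounds played so far,
each round consisting of Adam's vector followed by Eve's vector. -/
abbrev RGHist : Type := List ((ℤ × ℤ) × (ℤ × ℤ))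

/-- A strategy of Eve: a function from histories and Adam's current vector to a vector. -/
abbrev RGEStrat : Type := RGHist → (ℤ × ℤ) → ℤ × ℤ

/-- A strategy of Adam: a function from histories to a vector. -/
abbrev RGAStrat : Type := RGHist → ℤ × ℤ

/-- The vector reached from `x0` after playing the history `h`. -/
def rgPosAfter (x0 : ℤ × ℤ) (h : RGHist) : ℤ × ℤ :=
  h.foldl (fun v mv => v + mv.1 + mv.2) x0

/-- The history of the first `k` rounds when Eve plays `σ` and Adam plays `τ`. -/
def rgPlay (σ : RGEStrat) (τ : RGAStrat) : ℕ → RGHist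
  | 0 => []
  | k + 1 =>
      rgPlay σ τ k ++
        [(τ (rgPlay σ τ k), σ (rgPlay σ τ k) (τ (rgPlay σ τ k)))]

/-- The play of `σ` against `τ` from `x0` is won by Eve: at some round Eve has
played moves of `E` so far and the vector is `(0, 0)` after her move. -/
def RGEveWinsPlay (E : Set (ℤ × ℤ)) (x0 : ℤ × ℤ) (σ : RGEStrat) (τ : RGAStrat) : Prop :=
  ∃ k, (∀ j ≤ k, σ (rgPlay σ τ j) (τ (rgPlay σ τ j)) ∈ E) ∧
    rgPosAfter x0 (rgPlay σ τ (k + 1)) = 0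

/-- Eve has a winning strategy in the robot game `(A, E)` from the initial vector
`x0` (Adam to move): she has a strategy such that every play consistent with it
is won by her. -/
def RGEveWins (E A : Set (ℤ × ℤ)) (x0 : ℤ × ℤ) : Prop :=
  ∃ σ : RGEStrat, ∀ τ : RGAStrat,
    (∀ k, τ (rgPlay σ τ k) ∈ A) → RGEveWinsPlay E x0 σ τ

/-- Adam has a winning strategy in the robot game `(A, E)` from `x0` (Adam to
move): he has a (legal) strategy such that no play consistent with it is won by
Eve. -/
def RGAdamWins (E A : Set (ℤ × ℤ)) (x0 : ℤ × ℤ) : Prop :=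
  ∃ τ : RGAStrat, (∀ σ k, τ (rgPlay σ τ k) ∈ A) ∧
    ∀ σ, ¬ RGEveWinsPlay E x0 σ τ

/-- `Add(1,x) = (x, 0)`. -/
def addC1 (x : ℤ) : ℤ × ℤ := (x, 0)

/-- `Add(2,y) = (0, 4·y·8ⁿ)` where `n = m + 7`. -/
def addC2 (m : ℕ) (y : ℤ) : ℤ × ℤ := (0, 4 * y * 8 ^ (m + 7))

/-- `Move(j,k) = (0, -8ʲ + 8ᵏ)`. -/
def mvVec (j k : ℕ) : ℤ × ℤ := (0, -(8 : ℤ) ^ j + 8 ^ k)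

/-- `Check(i) = (0, -5·8ⁱ - 8ⁿ)` where `n = m + 7`. -/
def checkVec (m i : ℕ) : ℤ × ℤ := (0, -5 * (8 : ℤ) ^ i - 8 ^ (m + 7))

/-- The indices of the emptying states
`⊤'0+ = m+1, ⊤0+ = m+2, ⊤'+0 = m+3, ⊤+0 = m+4, ⊤'++ = m+5, ⊤++ = m+6`
(the state `⊤00` has index `0`). -/
def topSet (m : ℕ) : Set ℕ := Set.Icc (m + 1) (m + 6)

/-- The index of the unprimed emptying state `⊤ab` for a pair of flags. -/
def topIdx (m : ℕ) : Bool × Bool → ℕ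
  | (true, true) => m + 6
  | (true, false) => m + 4
  | (false, true) => m + 2
  | (false, false) => 0

/-- The index of the primed emptying state `⊤'ab` for a pair of flags. -/
def topIdx' (m : ℕ) : Bool × Bool → ℕ
  | (true, true) => m + 5
  | (true, false) => m + 3
  | (false, true) => m + 1
  | (false, false) => 0

/-- The emptying gadget: the gadget of Section 3 of the paper with self-loops
replaced by alternation between primed and unprimed emptying states. Its
transitions `(j, (δ1, δ2), k)` go from emptying state `j` to emptying state `k`
while adding `(δ1, δ2)` to the simulated counters. -/
def gadget (m : ℕ) : Set (ℕ × (ℤ × ℤ) × ℕ) :=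
  { g | (∃ k, (k = m + 5 ∨ k = m + 4 ∨ k = m + 3 ∨ k = m + 2 ∨ k = m + 1 ∨ k = 0) ∧
          g = (m + 6, ((-4 : ℤ), (-1 : ℤ)), k)) ∨
        (∃ k, (k = m + 6 ∨ k = m + 4 ∨ k = m + 3 ∨ k = m + 2 ∨ k = m + 1 ∨ k = 0) ∧
          g = (m + 5, ((-4 : ℤ), (-1 : ℤ)), k)) ∨
        (∃ k, (k = m + 3 ∨ k = 0) ∧ g = (m + 4, ((-4 : ℤ), (0 : ℤ)), k)) ∨
        (∃ k, (k = m + 4 ∨ k = 0) ∧ g = (m + 3, ((-4 : ℤ), (0 : ℤ)), k)) ∨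
        (∃ k, (k = m + 1 ∨ k = 0) ∧ g = (m + 2, ((0 : ℤ), (-1 : ℤ)), k)) ∨
        (∃ k, (k = m + 2 ∨ k = 0) ∧ g = (m + 1, ((0 : ℤ), (-1 : ℤ)), k)) }

/-- Adam's moves in the constructed robot game: his regular moves `A1` together
with the state-checks `Check(i)`, `i ∈ T̂`. -/
def adamSet (m : ℕ) (A1 : Finset (ℤ × ℤ)) : Set (ℤ × ℤ) :=
  (↑A1 : Set (ℤ × ℤ)) ∪ { v | ∃ i ∈ topSet m, v = checkVec m i }

/-- The encoding of a 2RGS configuration `(s, (c1, c2))` as the vector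
`(c1, 4·c2·8ⁿ + 8ˢ - 8⁰)` of the constructed robot game. -/
def encVec (m : ℕ) (s : ℕ) (c : ℤ × ℤ) : ℤ × ℤ :=
  (c.1, 4 * c.2 * 8 ^ (m + 7) + 8 ^ s - 1)

/-- Eve's regular moves: the simulations `Add(1,x) + Add(2,y) + Move(s,t)` of the
moves `(s,(x,y),t)` of the 2RGS, together with the finishing moves
`Move(s00, ⊤00) - α`. -/
def regularSet (m : ℕ) (fl : ℕ → Bool × Bool) (E1 : Finset (ℕ × (ℤ × ℤ) × ℕ))
    (A1 : Finset (ℤ × ℤ)) : Set (ℤ × ℤ) :=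
  { v | (∃ e ∈ E1, v = addC1 e.2.1.1 + addC2 m e.2.1.2 + mvVec e.1 e.2.2) ∨
        (∃ s ∈ Finset.Icc 1 m, fl s = (false, false) ∧
          ∃ α ∈ A1, v = mvVec s 0 - α) }

/-- Eve's state-defence moves: emptying steps of the gadget cancelling any Adam
move, together with the connecting moves `Move(s_ab, k) - Check(i)`
(`k ∈ {⊤_ab, ⊤'_ab}`, `k ≠ i`) and `Move(s00, ⊤00) - Check(i)`. -/
def defenceSet (m : ℕ) (fl : ℕ → Bool × Bool) (A1 : Finset (ℤ × ℤ)) :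
    Set (ℤ × ℤ) :=
  { v | (∃ g ∈ gadget m, ∃ β ∈ adamSet m A1,
          v = (g.2.1.1, 4 * g.2.1.2 * 8 ^ (m + 7)) + mvVec g.1 g.2.2 - β) ∨
        (∃ s ∈ Finset.Icc 1 m, fl s ≠ (false, false) ∧ ∃ i ∈ topSet m, ∃ k,
          (k = topIdx m (fl s) ∨ k = topIdx' m (fl s)) ∧ k ≠ i ∧
          v = mvVec s k - checkVec m i) ∨
        (∃ s ∈ Finset.Icc 1 m, fl s = (false, false) ∧ ∃ i ∈ topSet m,
          v = mvVec s 0 - checkVec m i) }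

/-- Eve's moves in the constructed robot game. -/
def eveSet (m : ℕ) (fl : ℕ → Bool × Bool) (E1 : Finset (ℕ × (ℤ × ℤ) × ℕ))
    (A1 : Finset (ℤ × ℤ)) : Set (ℤ × ℤ) :=
  regularSet m fl E1 A1 ∪ defenceSet m fl A1

/-- A play following any strategy has one round per step. -/
theorem length_rgPlay (σ : RGEStrat) (τ : RGAStrat) (k : ℕ) : (rgPlay σ τ k).length = k := by
  induction k with
  | zero => rfl
  | succ k ih => simp [rgPlay, ih]

/-- If Eve can force the vector along a fixed sequence of vectors which reaches `0`,
whatever Adam plays, then she wins from the first vector of the sequence. -/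
theorem RGEveWins.of_forced_sequence {E A : Set (ℤ × ℤ)} (p : ℕ → ℤ × ℤ) (N : ℕ)
    (hstep : ∀ j ≤ N, ∀ β ∈ A, p (j + 1) - p j - β ∈ E) (hend : p (N + 1) = 0) :
    RGEveWins E A (p 0) := by
  refine ⟨fun h β => p (h.length + 1) - p h.length - β, fun τ hτ => ⟨N, ?_, ?_⟩⟩
  · intro j hj
    simp only [length_rgPlay]
    exact hstep j hj _ (hτ j)
  · rw [← hend]
    generalize N + 1 = k
    induction k with
    | zero => rfl
    | succ k ih =>
      rw [rgPosAfter] at ih ⊢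
      rw [rgPlay, List.foldl_append, ih]
      simp only [List.foldl_cons, List.foldl_nil, length_rgPlay]
      abel

/-- The flags recording which of two counters are positive. -/
def posFlags (x y : ℕ) : Bool × Bool := (decide (0 < x), decide (0 < y))

/-- The emptying state for a pair of flags, unprimed if `b` and primed otherwise. -/
def topChoice (m : ℕ) (b : Bool) (f : Bool × Bool) : ℕ :=
  if b then topIdx m f else topIdx' m f

/-- From counters that are not both zero, the gadget decrements every positive counter and
moves to the emptying state of the new flags with the other priming. -/
theorem topChoice_step_mem_gadget (m x y : ℕ) (b : Bool) (h : 0 < x ∨ 0 < y) :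
    (topChoice m b (posFlags x y),
      (4 * ((x - 1 : ℕ) : ℤ) - 4 * (x : ℤ), ((y - 1 : ℕ) : ℤ) - (y : ℤ)),
      topChoice m (!b) (posFlags (x - 1) (y - 1))) ∈ gadget m := by
  have key : ∀ z : ℕ, z = 0 ∨ z = 1 ∨ ∃ w, z = w + 2 := fun z => by
    rcases z with _ | _ | w <;> simp
  rcases key x with rfl | rfl | ⟨x, rfl⟩ <;> rcases key y with rfl | rfl | ⟨y, rfl⟩ <;>
    cases b <;>
    simp [topChoice, posFlags, topIdx, topIdx', gadget] at h ⊢ <;> omega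

/-- Changing the encoded configuration by a gadget step, while cancelling Adam's move,
is one of Eve's moves. -/
theorem encVec_sub_encVec_sub_mem_eveSet {m : ℕ} {fl : ℕ → Bool × Bool}
    {E1 : Finset (ℕ × (ℤ × ℤ) × ℕ)} {A1 : Finset (ℤ × ℤ)} {j k : ℕ} {c d β : ℤ × ℤ}
    (hg : (j, (d.1 - c.1, d.2 - c.2), k) ∈ gadget m) (hβ : β ∈ adamSet m A1) :
    encVec m k d - encVec m j c - β ∈ eveSet m fl E1 A1 := by
  refine Or.inr (Or.inl ⟨_, hg, β, hβ, ?_⟩)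
  ext
  · simp [encVec, mvVec]
  · simp only [encVec, mvVec, Prod.snd_sub, Prod.snd_add]
    ring

/-- Eve wins from an emptying state whose flags match the counters. -/
theorem eveWins_encVec_topChoice (m : ℕ) (fl : ℕ → Bool × Bool)
    (E1 : Finset (ℕ × (ℤ × ℤ) × ℕ)) (A1 : Finset (ℤ × ℤ)) (x y : ℕ) (b : Bool)
    (h : 0 < x ∨ 0 < y) :
    RGEveWins (eveSet m fl E1 A1) (adamSet m A1)
      (encVec m (topChoice m b (posFlags x y)) (4 * (x : ℤ), (y : ℤ))) := by
  let p : ℕ → ℤ × ℤ := fun j =>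
    encVec m (topChoice m (not^[j] b) (posFlags (x - j) (y - j)))
      (4 * ((x - j : ℕ) : ℤ), ((y - j : ℕ) : ℤ))
  refine RGEveWins.of_forced_sequence p (max x y - 1) (fun j hj β hβ => ?_) ?_
  · refine encVec_sub_encVec_sub_mem_eveSet ?_ hβ
    rw [Function.iterate_succ_apply']
    exact topChoice_step_mem_gadget m (x - j) (y - j) _ (by omega)
  · have hx : x - (max x y - 1 + 1) = 0 := by omega
    have hy : y - (max x y - 1 + 1) = 0 := by omega
    have htop : ∀ b', topChoice m b' (posFlags 0 0) = 0 := by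
      intro b'
      cases b' <;> rfl
    simp only [p, hx, hy, htop]
    simp [encVec]

/-- In the robot game constructed from a 2RGS `(A1, E1)`,
suppose Eve has played only correct regular moves (so the position encodes a
2RGS configuration `(s, (4x, y))` whose flags match the counters) and Adam plays
a state-check `Check(i)` for the first time.  Then Eve has a winning strategy
from the resulting position (Eve to move) starting with the state-defence move
`Move(s, k) - Check(i)` for some `k ∈ {⊤_ab, ⊤'_ab}` with `k ≠ i`: this move is
legal, and after playing it Eve has either already won or has a winning strategy
with Adam to move. -/
theorem eve_wins_after_state_check (m : ℕ) (fl : ℕ → Bool × Bool)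
    (E1 : Finset (ℕ × (ℤ × ℤ) × ℕ)) (A1 : Finset (ℤ × ℤ))
    (hE : ∀ e ∈ E1, e.1 ∈ Finset.Icc 1 m ∧ e.2.2 ∈ Finset.Icc 1 m ∧ e.1 ≠ e.2.2)
    (hA : ∀ a ∈ A1, a.2 = 0)
    (s : ℕ) (hs : s ∈ Finset.Icc 1 m) (x y : ℕ)
    (hfl1 : (fl s).1 = decide (0 < x)) (hfl2 : (fl s).2 = decide (0 < y))
    (i : ℕ) (hi : i ∈ topSet m) :
    ∃ k, (k = topIdx m (fl s) ∨ k = topIdx' m (fl s)) ∧ k ≠ i ∧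
      (mvVec s k - checkVec m i) ∈ eveSet m fl E1 A1 ∧
      ((encVec m s (4 * (x : ℤ), (y : ℤ)) + checkVec m i +
          (mvVec s k - checkVec m i) = 0) ∨
        RGEveWins (eveSet m fl E1 A1) (adamSet m A1)
          (encVec m s (4 * (x : ℤ), (y : ℤ)) + checkVec m i +
            (mvVec s k - checkVec m i))) := by
  have hfl : fl s = posFlags x y := Prod.ext hfl1 hfl2
  have hpos : ∀ k, encVec m s (4 * (x : ℤ), (y : ℤ)) + checkVec m i +
      (mvVec s k - checkVec m i) = encVec m k (4 * (x : ℤ), (y : ℤ)) := by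
    intro k
    ext
    · simp [encVec, mvVec]
    · simp only [encVec, mvVec, Prod.snd_sub, Prod.snd_add]
      ring
  have hi0 : 0 < i := by
    have := hi.1
    omega
  simp only [hpos]
  by_cases h : 0 < x ∨ 0 < y
  · have hne : fl s ≠ (false, false) := by
      simp only [hfl, posFlags, ne_eq, Prod.mk.injEq, decide_eq_false_iff_not]
      omega
    have hdiff : topIdx m (fl s) ≠ topIdx' m (fl s) := by
      revert hne
      rcases fl s with ⟨_ | _, _ | _⟩ <;> simp [topIdx, topIdx']
    obtain ⟨b, hb⟩ : ∃ b, topChoice m b (fl s) ≠ i := by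
      by_cases hk : topIdx m (fl s) = i
      · exact ⟨false, fun h' => hdiff (hk.trans h'.symm)⟩
      · exact ⟨true, hk⟩
    have hmem : topChoice m b (fl s) = topIdx m (fl s) ∨
        topChoice m b (fl s) = topIdx' m (fl s) := by
      cases b <;> simp [topChoice]
    exact ⟨_, hmem, hb, Or.inr (Or.inr (Or.inl ⟨s, hs, hne, i, hi, _, hmem, hb, rfl⟩)),
      Or.inr (hfl ▸ eveWins_encVec_topChoice m fl E1 A1 x y b h)⟩
  · obtain ⟨rfl, rfl⟩ : x = 0 ∧ y = 0 := by omega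
    have hff : fl s = (false, false) := hfl
    refine ⟨0, Or.inl (by rw [hff, topIdx]), hi0.ne,
      Or.inr (Or.inr (Or.inr ⟨s, hs, hff, i, hi, rfl⟩)), Or.inl ?_⟩
    simp [encVec]
end

section
/- It is undecidable whether Eve has a winning strategy in a three-dimensional matrix game: under a fixed effective encoding of instances, the set of codes of tuples (U,V,x0,y) — finite sets U, V ⊆ ℤ^{3×3} of Eve's and Adam's matrices, an initial row vector x0 ∈ ℤ³ and a target vector y ∈ ℤ³ — such that Eve has a winning strategy to reach y from x0, is not a computable set. -/
/-- A `3 × 3` integer matrix. -/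
abbrev MGMat : Type := Matrix (Fin 3) (Fin 3) ℤ

/-- A row vector in `ℤ³`. -/
abbrev MGVec : Type := Fin 3 → ℤ

/-- A history of a play of a matrix game: the rounds played so far, each round
consisting of Adam's matrix followed by Eve's matrix. -/
abbrev MGHist : Type := List (MGMat × MGMat)

/-- A strategy of Eve: a function from histories and Adam's current matrix to a matrix. -/
abbrev MGEStrat : Type := MGHist → MGMat → MGMat

/-- A strategy of Adam: a function from histories to a matrix. -/
abbrev MGAStrat : Type := MGHist → MGMat

/-- The row vector reached from `x0` after playing the history `h`
(matrices act by multiplication on the right). -/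
def mgVecAfter (x0 : MGVec) (h : MGHist) : MGVec :=
  h.foldl (fun v p => Matrix.vecMul (Matrix.vecMul v p.1) p.2) x0

/-- The history of the first `k` rounds when Eve plays `σ` and Adam plays `τ`. -/
def mgPlay (σ : MGEStrat) (τ : MGAStrat) : ℕ → MGHist
  | 0 => []
  | k + 1 =>
      mgPlay σ τ k ++
        [(τ (mgPlay σ τ k), σ (mgPlay σ τ k) (τ (mgPlay σ τ k)))]

/-- The play of `σ` against `τ` from `x0` is won by Eve: at some round Eve has
played matrices of `U` so far and the vector equals the target `y` after her move. -/
def MGEveWinsPlay (U : Set MGMat) (x0 y : MGVec) (σ : MGEStrat) (τ : MGAStrat) : Prop :=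
  ∃ k, (∀ j ≤ k, σ (mgPlay σ τ j) (τ (mgPlay σ τ j)) ∈ U) ∧
    mgVecAfter x0 (mgPlay σ τ (k + 1)) = y

/-- Eve has a winning strategy in the matrix game with Eve's matrices `U`,
Adam's matrices `V`, initial row vector `x0` and target vector `y`
(Adam to move): she has a strategy such that every play consistent with it is
won by her. -/
def MGEveWins (U V : Set MGMat) (x0 y : MGVec) : Prop :=
  ∃ σ : MGEStrat, ∀ τ : MGAStrat,
    (∀ k, τ (mgPlay σ τ k) ∈ V) → MGEveWinsPlay U x0 y σ τ

/-- A vector in `ℤ³` given as a triple. -/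
abbrev V3 : Type := ℤ × ℤ × ℤ

/-- A `3 × 3` integer matrix given as a triple of rows. -/
abbrev M3 : Type := V3 × V3 × V3

/-- The data of an instance of the decision problem for three-dimensional matrix
games: Eve's matrices, Adam's matrices, the initial row vector and the target
vector; the fixed effective encoding is `Encodable.encode` on this type. -/
abbrev MGData : Type := List M3 × List M3 × V3 × V3

/-- The row vector represented by a triple. -/
def toVec (v : V3) : MGVec := ![v.1, v.2.1, v.2.2]

/-- The matrix represented by a triple of rows. -/
def toMat (r : M3) : MGMat := Matrix.of ![toVec r.1, toVec r.2.1, toVec r.2.2]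

/-! ### Counter programs -/

/-- Programs on counters: `loop i P` decrements counter `i` and then runs `P`, as long as
counter `i` is nonzero. -/
inductive CounterProg : Type
  | skip : CounterProg
  | inc (i : ℕ) : CounterProg
  | seq (P Q : CounterProg) : CounterProg
  | loop (i : ℕ) (P : CounterProg) : CounterProg
  deriving Countable

namespace CounterProg

open Finsupp

/-- Big-step semantics of counter programs. -/
inductive Exec : CounterProg → (ℕ →₀ ℕ) → (ℕ →₀ ℕ) → Prop
  | skip (σ : ℕ →₀ ℕ) : Exec skip σ σ
  | inc (i : ℕ) (σ : ℕ →₀ ℕ) : Exec (inc i) σ (σ + single i 1)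
  | seq {P Q : CounterProg} {σ τ ρ : ℕ →₀ ℕ} : Exec P σ τ → Exec Q τ ρ → Exec (seq P Q) σ ρ
  | loop_zero {i : ℕ} {P : CounterProg} {σ : ℕ →₀ ℕ} : σ i = 0 → Exec (loop i P) σ σ
  | loop_succ {i : ℕ} {P : CounterProg} {σ σ' τ ρ : ℕ →₀ ℕ} : σ = σ' + single i 1 →
      Exec P σ' τ → Exec (loop i P) τ ρ → Exec (loop i P) σ ρ

theorem Exec.deterministic {P : CounterProg} {σ τ τ' : ℕ →₀ ℕ} (h : Exec P σ τ)
    (h' : Exec P σ τ') : τ = τ' := by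
  induction h generalizing τ' with
  | skip => cases h'; rfl
  | inc => cases h'; rfl
  | seq _ _ ih₁ ih₂ =>
    cases h' with
    | seq h₁ h₂ => exact ih₂ (ih₁ h₁ ▸ h₂)
  | loop_zero h =>
    cases h' with
    | loop_zero => rfl
    | loop_succ e => simp [e] at h
  | loop_succ e _ _ ih₁ ih₂ =>
    cases h' with
    | loop_zero h => simp [e] at h
    | loop_succ e' h₁ h₂ =>
      obtain rfl := add_right_cancel (e.symm.trans e')
      exact ih₂ (ih₁ h₁ ▸ h₂)

theorem exec_loop_of_forall_add {P : CounterProg} {i : ℕ} {δ : ℕ →₀ ℕ} (hδ : δ i = 0)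
    (hP : ∀ σ, Exec P σ (σ + δ)) (n : ℕ) (σ : ℕ →₀ ℕ) (hσ : σ i = 0) :
    Exec (loop i P) (σ + single i n) (σ + n • δ) := by
  induction n generalizing σ with
  | zero => simpa using Exec.loop_zero hσ
  | succ n ih =>
    refine Exec.loop_succ (σ' := σ + single i n) (by rw [single_add, add_assoc]) (hP _) ?_
    have := ih (σ + δ) (by simp [hσ, hδ])
    rwa [add_right_comm, succ_nsmul', ← add_assoc]

theorem exec_clear {i : ℕ} {σ : ℕ →₀ ℕ} (hσ : σ i = 0) (n : ℕ) :
    Exec (loop i skip) (σ + single i n) σ := by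
  simpa using exec_loop_of_forall_add (P := skip) (δ := 0) (i := i) rfl
    (fun σ => by simpa using Exec.skip σ) n σ hσ

theorem exec_move {i j : ℕ} (hij : i ≠ j) {σ : ℕ →₀ ℕ} (hσ : σ i = 0) (n : ℕ) :
    Exec (loop i (inc j)) (σ + single i n) (σ + single j n) := by
  simpa using exec_loop_of_forall_add (P := inc j) (i := i) (by simp [hij.symm])
    (Exec.inc j) n σ hσ

/-- Add counter `i` to counter `j`, using the zero counter `t` as scratch space. -/
def copy (i j t : ℕ) : CounterProg :=
  seq (loop i (seq (inc j) (inc t))) (loop t (inc i))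

theorem exec_copy {i j t : ℕ} (hij : i ≠ j) (hit : i ≠ t) (hjt : j ≠ t) {σ : ℕ →₀ ℕ}
    (ht : σ t = 0) : Exec (copy i j t) σ (σ + single j (σ i)) := by
  have h₁ := exec_loop_of_forall_add (P := seq (inc j) (inc t)) (i := i)
    (δ := single j 1 + single t 1) (by simp [hij.symm, hit.symm])
    (fun σ => by
      have := Exec.seq (Exec.inc j σ) (Exec.inc t _)
      rwa [add_assoc] at this) (σ i) (σ.erase i) (by simp)
  have h₂ := exec_move (i := t) (j := i) hit.symm (σ := σ.erase i + single j (σ i))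
    (by simp [hit.symm, hjt, ht]) (σ i)
  have e₁ : σ.erase i + single i (σ i) = σ := by rw [add_comm, single_add_erase]
  have e₂ : σ.erase i + single j (σ i) + single i (σ i) = σ + single j (σ i) := by
    rw [add_right_comm, e₁]
  rw [e₁] at h₁
  rw [e₂] at h₂
  refine Exec.seq h₁ ?_
  simpa [add_assoc] using h₂

/-- A function is realizable if, for every choice of input counters and of an output counter,
some program adds its value to the (zero) output counter and leaves everything else unchanged,
provided all counters from some bound on are zero. -/
def Realizable {n : ℕ} (f : List.Vector ℕ n → ℕ) : Prop :=
  ∀ (inp : Fin n → ℕ) (out m : ℕ), (∀ i, inp i < m) → out < m → (∀ i, inp i ≠ out) →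
    ∃ P : CounterProg, ∀ σ : ℕ →₀ ℕ, (∀ r, m ≤ r → σ r = 0) → σ out = 0 →
      Exec P σ (σ + single out (f (List.Vector.ofFn fun i => σ (inp i))))

theorem realizable_get {n : ℕ} (i : Fin n) : Realizable fun v : List.Vector ℕ n => v.get i := by
  intro inp out m hinp hout hne
  refine ⟨copy (inp i) out m, fun σ hσ _ => ?_⟩
  simpa using exec_copy (hne i) (hinp i).ne hout.ne (hσ m le_rfl)

theorem realizable_succ : Realizable fun v : List.Vector ℕ 1 => v.head.succ := by
  intro inp out m hinp hout hne
  refine ⟨seq (copy (inp 0) out m) (inc out), fun σ hσ _ => ?_⟩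
  have := Exec.seq (exec_copy (hne 0) (hinp 0).ne hout.ne (hσ m le_rfl)) (Exec.inc out _)
  rwa [add_assoc, ← single_add] at this

/-- The counters `m, …, m + j - 1` hold the values of `G`. -/
noncomputable def block (m : ℕ) (G : ℕ → ℕ) (j : ℕ) : ℕ →₀ ℕ :=
  ∑ i ∈ Finset.range j, single (m + i) (G i)

theorem block_succ (m : ℕ) (G : ℕ → ℕ) (j : ℕ) :
    block m G (j + 1) = block m G j + single (m + j) (G j) :=
  Finset.sum_range_succ _ _

theorem block_apply_of_le (m : ℕ) (G : ℕ → ℕ) (j r : ℕ) (h : m + j ≤ r) : block m G j r = 0 := by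
  induction j with
  | zero => simp [block]
  | succ j ih =>
    rw [block_succ, Finsupp.add_apply, ih (by omega), single_eq_of_ne (by omega), add_zero]

theorem block_apply_of_lt (m : ℕ) (G : ℕ → ℕ) (j r : ℕ) (h : r < m) : block m G j r = 0 := by
  induction j with
  | zero => simp [block]
  | succ j ih =>
    rw [block_succ, Finsupp.add_apply, ih, single_eq_of_ne (by omega), add_zero]

theorem block_apply (m : ℕ) (G : ℕ → ℕ) (j i : ℕ) (h : i < j) : block m G j (m + i) = G i := by
  induction j with
  | zero => omega
  | succ j ih =>
    rw [block_succ, Finsupp.add_apply]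
    rcases Nat.lt_succ_iff_lt_or_eq.1 h with h | rfl
    · rw [ih h, single_eq_of_ne (by omega), add_zero]
    · rw [block_apply_of_le _ _ _ _ le_rfl, single_eq_same, zero_add]

theorem exists_exec_clear_block (m j : ℕ) : ∃ P : CounterProg, ∀ (G : ℕ → ℕ) (σ : ℕ →₀ ℕ),
    (∀ r, m ≤ r → σ r = 0) → Exec P (σ + block m G j) σ := by
  induction j with
  | zero => exact ⟨skip, fun G σ _ => by simpa [block] using Exec.skip σ⟩
  | succ j ih =>
    obtain ⟨P, hP⟩ := ih
    refine ⟨seq (loop (m + j) skip) P, fun G σ hσ => ?_⟩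
    rw [block_succ, ← add_assoc]
    refine Exec.seq (exec_clear ?_ _) (hP G σ hσ)
    rw [Finsupp.add_apply, hσ _ (by omega), block_apply_of_le _ _ _ _ le_rfl]

theorem realizable_comp {n k : ℕ} {f : List.Vector ℕ n → ℕ} (g : Fin n → List.Vector ℕ k → ℕ)
    (hf : Realizable f) (hg : ∀ i, Realizable (g i)) :
    Realizable fun a => f (List.Vector.ofFn fun i => g i a) := by
  intro inp out m hinp hout hne
  let G : (ℕ →₀ ℕ) → ℕ → ℕ := fun σ i =>
    if h : i < n then g ⟨i, h⟩ (List.Vector.ofFn fun i => σ (inp i)) else 0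
  have hargs : ∀ j ≤ n, ∃ P : CounterProg, ∀ σ : ℕ →₀ ℕ, (∀ r, m ≤ r → σ r = 0) →
      Exec P σ (σ + block m (G σ) j) := by
    intro j
    induction j with
    | zero => exact fun _ => ⟨skip, fun σ _ => by simpa [block] using Exec.skip σ⟩
    | succ j ih =>
      intro hj
      obtain ⟨P, hP⟩ := ih (by omega)
      obtain ⟨Q, hQ⟩ := hg ⟨j, hj⟩ inp (m + j) (m + n) (fun i => by have := hinp i; omega)
        (by omega) (fun i => by have := hinp i; omega)
      refine ⟨seq P Q, fun σ hσ => Exec.seq (hP σ hσ) ?_⟩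
      have := hQ (σ + block m (G σ) j)
        (fun r hr => by
          rw [Finsupp.add_apply, hσ _ (by omega), block_apply_of_le _ _ _ _ (by omega)])
        (by rw [Finsupp.add_apply, hσ _ (by omega), block_apply_of_le _ _ _ _ le_rfl])
      have e : (fun i => (σ + block m (G σ) j) (inp i)) = fun i => σ (inp i) := by
        funext i
        rw [Finsupp.add_apply, block_apply_of_lt _ _ _ _ (hinp i), add_zero]
      rw [e, add_assoc] at this
      rw [block_succ]
      simpa [G, Nat.lt_of_succ_le hj] using this
  obtain ⟨P, hP⟩ := hargs n le_rfl
  obtain ⟨Q, hQ⟩ := hf (fun i => m + i) out (m + n) (fun i => by omega) (by omega)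
    (fun i => by omega)
  obtain ⟨R, hR⟩ := exists_exec_clear_block m n
  refine ⟨seq P (seq Q R), fun σ hσ ho => Exec.seq (hP σ hσ) (Exec.seq (hQ _ ?_ ?_) ?_)⟩
  · intro r hr
    rw [Finsupp.add_apply, hσ _ (by omega), block_apply_of_le _ _ _ _ hr]
  · rw [Finsupp.add_apply, ho, block_apply_of_lt _ _ _ _ hout]
  · have e : (fun i : Fin n => (σ + block m (G σ) n) (m + i)) =
        fun i => g i (List.Vector.ofFn fun i => σ (inp i)) := by
      funext i
      rw [Finsupp.add_apply, hσ _ (by omega), block_apply _ _ _ _ i.2]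
      simp [G]
    rw [e, add_right_comm]
    refine hR _ _ fun r hr => ?_
    rw [Finsupp.add_apply, hσ _ hr, single_eq_of_ne (by omega), add_zero]

theorem realizable_prec {n : ℕ} {f : List.Vector ℕ n → ℕ} {g : List.Vector ℕ (n + 2) → ℕ}
    (hf : Realizable f) (hg : Realizable g) :
    Realizable fun v : List.Vector ℕ (n + 1) =>
      v.head.rec (f v.tail) fun y IH => g (y ::ᵥ IH ::ᵥ v.tail) := by
  intro inp out m hinp hout hne
  obtain ⟨P, hP⟩ := hf (fun i => inp i.succ) out m (fun i => hinp _) hout (fun i => hne _)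
  obtain ⟨Q, hQ⟩ := hg (Fin.cons (m + 1) (Fin.cons out fun i => inp i.succ)) (m + 2) (m + 3)
    (fun i => by
      refine Fin.cases ?_ (fun i => Fin.cases ?_ (fun i => ?_) i) i
      · simp
      · simp; omega
      · have := hinp i.succ
        simp; omega)
    (by omega)
    (fun i => by
      refine Fin.cases ?_ (fun i => Fin.cases ?_ (fun i => ?_) i) i
      · simp
      · simp; omega
      · have := hinp i.succ
        simp; omega)
  let B := seq Q (seq (loop out skip) (seq (loop (m + 2) (inc out)) (inc (m + 1))))
  refine ⟨seq P (seq (copy (inp 0) m (m + 1)) (seq (loop m B) (loop (m + 1) skip))),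
    fun σ hσ ho => ?_⟩
  set w : List.Vector ℕ n := List.Vector.ofFn fun i => σ (inp i.succ) with hw
  let F : ℕ → ℕ := fun N => N.rec (f w) fun y IH => g (y ::ᵥ IH ::ᵥ w)
  have hbody : ∀ N j : ℕ,
      Exec B (σ + single m N + single (m + 1) j + single out (F j))
        (σ + single m N + single (m + 1) (j + 1) + single out (F (j + 1))) := by
    intro N j
    set ρ := σ + single m N + single (m + 1) j with hρ
    have hρo : ρ out = 0 := by
      simp [hρ, ho, single_apply]; omega
    have hρ2 : ρ (m + 2) = 0 := by
      simp [hρ, hσ]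
    have h₁ := hQ (ρ + single out (F j))
      (fun r hr => by
        simp only [hρ, Finsupp.add_apply, single_apply]
        rw [hσ r (by omega), if_neg (by omega), if_neg (by omega), if_neg (by omega)]
        rfl)
      (by rw [Finsupp.add_apply, hρ2, single_eq_of_ne (by omega), add_zero])
    have e : (List.Vector.ofFn fun i => (ρ + single out (F j))
        ((Fin.cons (m + 1) (Fin.cons out fun i => inp i.succ) : Fin (n + 2) → ℕ) i)) =
        j ::ᵥ F j ::ᵥ w := by
      have e₀ : (ρ + single out (F j)) (m + 1) = j := by
        have ho' : out ≠ m + 1 := by omega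
        simp [hρ, hσ, ho']
      have e₁ : (ρ + single out (F j)) out = F j := by
        rw [Finsupp.add_apply, hρo, single_eq_same, zero_add]
      have e₂ : ∀ i : Fin n, (ρ + single out (F j)) (inp i.succ) = σ (inp i.succ) := by
        intro i
        have := hinp i.succ
        have := hne i.succ
        simp only [hρ, Finsupp.add_apply, single_apply]
        rw [if_neg (by omega), if_neg (by omega), if_neg (by omega)]
        omega
      simp only [List.Vector.ofFn, Fin.cons_zero, Fin.cons_succ, e₀, e₁, e₂, hw]
    rw [e, add_right_comm ρ] at h₁
    refine Exec.seq h₁ (Exec.seq (exec_clear ?_ _) (Exec.seq (exec_move (by omega) hρ2 _) ?_))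
    · rw [Finsupp.add_apply, hρo, single_eq_of_ne (by omega), add_zero]
    · have := Exec.inc (m + 1) (ρ + single out (F (j + 1)))
      have e' : ρ + single (m + 1) 1 = σ + single m N + single (m + 1) (j + 1) := by
        rw [hρ, add_assoc, ← single_add]
      rwa [add_right_comm ρ, e'] at this
  have hloop : ∀ N j : ℕ,
      Exec (loop m B) (σ + single m N + single (m + 1) j + single out (F j))
        (σ + single (m + 1) (j + N) + single out (F (j + N))) := by
    intro N
    induction N with
    | zero =>
      intro j
      simp only [single_zero, add_zero]
      refine Exec.loop_zero ?_
      simp only [Finsupp.add_apply, single_apply]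
      rw [hσ _ le_rfl, if_neg (by omega), if_neg (by omega)]
      rfl
    | succ N ih =>
      intro j
      refine Exec.loop_succ ?_ (hbody N j) ?_
      · rw [single_add]
        abel
      · have := ih (j + 1)
        rwa [add_assoc j, add_comm 1 N] at this
  refine Exec.seq (hP σ hσ ho) ?_
  have hc := exec_copy (i := inp 0) (j := m) (t := m + 1)
    (σ := σ + single out (f w)) (hinp 0).ne (by have := hinp 0; omega) (by omega)
    (by rw [Finsupp.add_apply, hσ _ (by omega), single_eq_of_ne (by omega), add_zero])
  refine Exec.seq hc ?_
  have e : (σ + single out (f w)) (inp 0) = σ (inp 0) := by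
    rw [Finsupp.add_apply, single_eq_of_ne (hne 0), add_zero]
  rw [e]
  have hl := hloop (σ (inp 0)) 0
  rw [single_zero, add_zero, zero_add, add_right_comm] at hl
  refine Exec.seq hl ?_
  rw [add_right_comm]
  refine exec_clear ?_ _
  rw [Finsupp.add_apply, hσ _ (by omega), single_eq_of_ne (by omega), add_zero]

theorem realizable_of_primrec' {n : ℕ} {f : List.Vector ℕ n → ℕ} (hf : Nat.Primrec' f) :
    Realizable f := by
  induction hf with
  | zero => exact fun _ _ _ _ _ _ => ⟨skip, fun σ _ _ => by simpa using Exec.skip σ⟩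
  | succ => exact realizable_succ
  | get i => exact realizable_get i
  | comp g _ _ ihf ihg => exact realizable_comp g ihf ihg
  | prec _ _ ihf ihg => exact realizable_prec ihf ihg

/-- Unbounded search is performed by a counter program. -/
theorem exists_exec_iff_of_primrec {g : ℕ → ℕ → ℕ} (hg : Primrec₂ g) :
    ∃ P : CounterProg, ∀ n : ℕ, Exec P (single 0 n) 0 ↔ ∃ k, g k n = 0 := by
  obtain ⟨G, hG⟩ := realizable_of_primrec' (Nat.Primrec'.prim_iff₂.2 hg) ![1, 0] 2 3
    (by decide) (by decide) (by decide)
  let B := seq (loop 2 skip) (seq (inc 1) G)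
  have hstart : ∀ n k, Exec G (single 0 n + single 1 k)
      (single 0 n + single 1 k + single 2 (g k n)) := by
    intro n k
    have := hG (single 0 n + single 1 k)
      (fun r hr => by
        rw [Finsupp.add_apply, single_eq_of_ne (by omega), single_eq_of_ne (by omega), add_zero]) (by simp)
    simpa [List.Vector.ofFn] using this
  have hbody : ∀ n k a, Exec B (single 0 n + single 1 k + single 2 a)
      (single 0 n + single 1 (k + 1) + single 2 (g (k + 1) n)) := by
    intro n k a
    refine Exec.seq (exec_clear (by simp) _) (Exec.seq (Exec.inc 1 _) ?_)
    rw [add_assoc (single 0 n), ← single_add]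
    exact hstart n (k + 1)
  refine ⟨seq G (seq (loop 2 B) (seq (loop 1 skip) (loop 0 skip))), fun n => ⟨fun h => ?_, ?_⟩⟩
  · have hs := hstart n 0
    rw [single_zero, add_zero] at hs
    cases h with
    | seq h₁ h₂ =>
      cases h₂ with
      | @seq _ _ _ ρ _ h₂ _ =>
        obtain rfl := hs.deterministic h₁
        have key : ∀ (R : CounterProg) (σ τ : ℕ →₀ ℕ), Exec R σ τ → R = loop 2 B →
            ∀ k, σ = single 0 n + single 1 k + single 2 (g k n) → ∃ k, g k n = 0 := by
          intro R σ τ h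
          induction h with
          | skip | inc | seq => exact fun e => by cases e
          | loop_zero h =>
            intro e k hk
            cases e
            exact ⟨k, by simpa [hk] using h⟩
          | @loop_succ i P σ σ' τ ρ e h₁ _ _ ih₂ =>
            intro e' k hk
            cases e'
            refine ih₂ rfl (k + 1) ?_
            rw [hk] at e
            obtain ⟨a, ha⟩ : ∃ a, g k n = a + 1 := by
              refine Nat.exists_eq_succ_of_ne_zero fun h0 => ?_
              have := DFunLike.congr_fun e 2
              simp [h0] at this
            rw [ha, single_add, ← add_assoc] at e
            obtain rfl := add_right_cancel e
            exact h₁.deterministic (hbody n k a)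
        exact key _ _ _ h₂ rfl 0 (by simp)
  · intro hex
    have hloop : ∀ k, (∀ j < k, g j n ≠ 0) → g k n = 0 → ∀ d ≤ k,
        Exec (loop 2 B) (single 0 n + single 1 (k - d) + single 2 (g (k - d) n))
          (single 0 n + single 1 k) := by
      intro k hlt hk d
      induction d with
      | zero =>
        intro _
        simpa [hk] using
          Exec.loop_zero (P := B) (σ := single 0 n + single 1 k) (i := 2) (by simp)
      | succ d ih =>
        intro hd
        obtain ⟨a, ha⟩ := Nat.exists_eq_succ_of_ne_zero (hlt (k - (d + 1)) (by omega))
        refine Exec.loop_succ (σ' := single 0 n + single 1 (k - (d + 1)) + single 2 a)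
          (by rw [ha, Nat.succ_eq_add_one, single_add, ← add_assoc]) (hbody n _ a) ?_
        rw [show k - (d + 1) + 1 = k - d by omega]
        exact ih (by omega)
    have hl := hloop (Nat.find hex) (fun j hj => Nat.find_min hex hj) (Nat.find_spec hex)
      (Nat.find hex) le_rfl
    rw [Nat.sub_self, single_zero, add_zero] at hl
    have hs := hstart n 0
    rw [single_zero, add_zero] at hs
    refine Exec.seq hs (Exec.seq hl (Exec.seq (exec_clear (by simp) _) ?_))
    simpa using exec_clear (i := 0) (σ := 0) (by simp) n

end CounterProg

/-! ### Encoding counter programs by multiplication and division of integers -/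

/-- One step of a multiplicative rewriting system on natural numbers: multiply by a fraction
`r.1 / r.2` from the list of rules, so that no forbidden number divides the result. -/
def DivStep (rules : List (ℕ × ℕ)) (forb : List ℕ) (x x' : ℕ) : Prop :=
  (∃ r ∈ rules, r.2 * x' = r.1 * x) ∧ ∀ f ∈ forb, ¬ f ∣ x'

namespace CounterProg

open Finsupp Relation

/-- Names of the primes used in the encoding: one for each counter, one for each list of programs
that remain to be run, and one for each loop that is about to be left. -/
inductive Place : Type
  | reg (i : ℕ) : Place
  | start (k : List CounterProg) : Place
  | exit (k : List CounterProg) : Place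
  deriving Countable

theorem exists_injective_prime : ∃ π : Place → ℕ, Function.Injective π ∧ ∀ a, (π a).Prime := by
  obtain ⟨e, he⟩ := exists_injective_nat Place
  exact ⟨fun a => Nat.nth Nat.Prime (e a),
    (Nat.nth_injective Nat.infinite_setOfPred_prime).comp he, fun a => Nat.prime_nth_prime _⟩

/-- Run the programs of a list one after the other. -/
def ExecAll : List CounterProg → (ℕ →₀ ℕ) → (ℕ →₀ ℕ) → Prop
  | [], σ, τ => σ = τ
  | P :: k, σ, τ => ∃ ρ, Exec P σ ρ ∧ ExecAll k ρ τ

/-- The lists of programs met while running `P` with `k` remaining. -/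
def conts : CounterProg → List CounterProg → List (List CounterProg)
  | skip, k => [skip :: k]
  | inc i, k => [inc i :: k]
  | seq P Q, k => (seq P Q :: k) :: (conts P (Q :: k) ++ conts Q k)
  | loop i P, k => (loop i P :: k) :: conts P (loop i P :: k)

/-- The number encoding the values of the counters. -/
noncomputable def enc (π : Place → ℕ) (σ : ℕ →₀ ℕ) : ℕ :=
  σ.prod fun i e => π (.reg i) ^ e

/-- The fractions simulating the first program of a list. -/
def rulesOf (π : Place → ℕ) : List CounterProg → List (ℕ × ℕ)
  | [] => []
  | skip :: k => [(π (.start k), π (.start (skip :: k)))]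
  | inc i :: k => [(π (.start k) * π (.reg i), π (.start (inc i :: k)))]
  | seq P Q :: k => [(π (.start (P :: Q :: k)), π (.start (seq P Q :: k)))]
  | loop i P :: k =>
    [(π (.start (P :: loop i P :: k)), π (.start (loop i P :: k)) * π (.reg i)),
      (π (.exit (loop i P :: k)), π (.start (loop i P :: k))),
      (π (.start k), π (.exit (loop i P :: k)))]

/-- The numbers expressing that a loop is left although its counter is nonzero. -/
def forbOf (π : Place → ℕ) : List CounterProg → List ℕ
  | loop i P :: k => [π (.exit (loop i P :: k)) * π (.reg i)]
  | _ => []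

theorem mem_forbOf {π : Place → ℕ} {s : List CounterProg} {f : ℕ} (h : f ∈ forbOf π s) :
    ∃ i P k, s = loop i P :: k ∧ f = π (.exit s) * π (.reg i) := by
  rcases s with _ | ⟨_ | _ | _ | ⟨i, P⟩, k⟩ <;> simp [forbOf] at h
  exact ⟨i, P, k, rfl, h⟩

section Encoding

variable {π : Place → ℕ}

theorem enc_add_single (σ : ℕ →₀ ℕ) (i n : ℕ) :
    enc π (σ + single i n) = enc π σ * π (.reg i) ^ n := by
  rw [enc, enc, prod_add_index' (by simp) (by simp [pow_add]), prod_single_index (by simp)]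

theorem dvd_enc_iff (hi : Function.Injective π) (hp : ∀ a, (π a).Prime) (a : Place)
    (σ : ℕ →₀ ℕ) : π a ∣ enc π σ ↔ ∃ i, a = .reg i ∧ σ i ≠ 0 := by
  rw [enc, Prime.dvd_finsuppProd_iff (hp a).prime]
  constructor
  · rintro ⟨i, hσ, hd⟩
    exact ⟨i, hi ((Nat.prime_dvd_prime_iff_eq (hp _) (hp _)).1 ((hp a).dvd_of_dvd_pow hd)),
      mem_support_iff.1 hσ⟩
  · rintro ⟨i, rfl, hσ⟩
    exact ⟨i, mem_support_iff.2 hσ, dvd_pow_self _ hσ⟩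

theorem eq_zero_of_enc_eq_one (hi : Function.Injective π) (hp : ∀ a, (π a).Prime)
    {σ : ℕ →₀ ℕ} (h : enc π σ = 1) : σ = 0 := by
  ext i
  by_contra hσ
  have := (dvd_enc_iff hi hp (.reg i) σ).2 ⟨i, rfl, hσ⟩
  rw [h] at this
  exact (hp _).one_lt.ne' (Nat.dvd_one.1 this)

theorem dvd_mul_enc (hi : Function.Injective π) (hp : ∀ a, (π a).Prime) {a c : Place}
    {σ : ℕ →₀ ℕ} (h : π a ∣ π c * enc π σ) : a = c ∨ ∃ i, a = .reg i ∧ σ i ≠ 0 := by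
  rcases (hp a).dvd_mul.1 h with h | h
  · exact .inl (hi ((Nat.prime_dvd_prime_iff_eq (hp _) (hp _)).1 h))
  · exact .inr ((dvd_enc_iff hi hp a σ).1 h)

theorem dvd_mul_mul_enc (hi : Function.Injective π) (hp : ∀ a, (π a).Prime) {a b c : Place}
    {σ : ℕ →₀ ℕ} (ha : ∀ i, a ≠ .reg i) (h : π a ∣ π b * (π c * enc π σ)) : a = b ∨ a = c := by
  rcases (hp a).dvd_mul.1 h with h | h
  · exact .inl (hi ((Nat.prime_dvd_prime_iff_eq (hp _) (hp _)).1 h))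
  · rcases dvd_mul_enc hi hp h with h | ⟨i, h, _⟩
    · exact .inr h
    · exact absurd h (ha i)

theorem not_dvd_start (hi : Function.Injective π) (hp : ∀ a, (π a).Prime)
    {S : List (List CounterProg)} (k : List CounterProg) (σ : ℕ →₀ ℕ) :
    ∀ f ∈ S.flatMap (forbOf π), ¬ f ∣ π (.start k) * enc π σ := by
  intro f hf hd
  obtain ⟨s, -, hf⟩ := List.mem_flatMap.1 hf
  obtain ⟨i, P, k, -, rfl⟩ := mem_forbOf hf
  rcases dvd_mul_enc hi hp (dvd_of_mul_right_dvd hd) with h | ⟨_, h, _⟩ <;> cases h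

theorem not_dvd_exit (hi : Function.Injective π) (hp : ∀ a, (π a).Prime)
    {S : List (List CounterProg)} {i : ℕ} {P : CounterProg} {k : List CounterProg}
    {σ : ℕ →₀ ℕ} (hσ : σ i = 0) :
    ∀ f ∈ S.flatMap (forbOf π), ¬ f ∣ π (.exit (loop i P :: k)) * enc π σ := by
  intro f hf hd
  obtain ⟨s, -, hf⟩ := List.mem_flatMap.1 hf
  obtain ⟨j, Q, l, rfl, rfl⟩ := mem_forbOf hf
  rcases dvd_mul_enc hi hp (dvd_of_mul_right_dvd hd) with h | ⟨_, h, _⟩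
  · cases h
    rcases dvd_mul_enc hi hp (dvd_of_mul_left_dvd hd) with h | ⟨_, h, h'⟩
    · cases h
    · cases h
      exact h' hσ
  · cases h

theorem Exec.reaches (hi : Function.Injective π) (hp : ∀ a, (π a).Prime)
    {S : List (List CounterProg)} {P : CounterProg} {σ τ : ℕ →₀ ℕ} (h : Exec P σ τ) :
    ∀ k, conts P k ⊆ S →
      ReflTransGen (DivStep (S.flatMap (rulesOf π)) (S.flatMap (forbOf π)))
        (π (.start (P :: k)) * enc π σ) (π (.start k) * enc π τ) := by
  have step {s : List CounterProg} (hs : s ∈ S) {r : ℕ × ℕ} (hr : r ∈ rulesOf π s) {x x' : ℕ}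
      (h : r.2 * x' = r.1 * x) (h' : ∀ f ∈ S.flatMap (forbOf π), ¬ f ∣ x') :
      DivStep (S.flatMap (rulesOf π)) (S.flatMap (forbOf π)) x x' :=
    ⟨⟨r, List.mem_flatMap.2 ⟨s, hs, hr⟩, h⟩, h'⟩
  induction h with
  | skip σ =>
    intro k hk
    refine .single (step (s := CounterProg.skip :: k) (hk (by simp [conts])) (List.mem_singleton_self _) ?_
      (not_dvd_start hi hp _ _))
    ring
  | inc i σ =>
    intro k hk
    refine .single (step (s := CounterProg.inc i :: k) (hk (by simp [conts])) (List.mem_singleton_self _) ?_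
      (not_dvd_start hi hp _ _))
    rw [enc_add_single]
    ring
  | @seq P Q σ τ ρ _ _ ih₁ ih₂ =>
    intro k hk
    simp only [conts, List.cons_subset, List.append_subset] at hk
    refine .head (step hk.1 (List.mem_singleton_self _) ?_ (not_dvd_start hi hp (P :: Q :: k) σ))
      ((ih₁ _ hk.2.1).trans (ih₂ _ hk.2.2))
    ring
  | @loop_zero i P σ h =>
    intro k hk
    simp only [conts, List.cons_subset] at hk
    refine .head (step hk.1 (r := (π (.exit (loop i P :: k)), π (.start (loop i P :: k))))
      (by simp [rulesOf]) ?_ (not_dvd_exit hi hp h (P := P) (k := k)))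
      (.single (step hk.1 (r := (π (.start k), π (.exit (loop i P :: k))))
      (by simp [rulesOf]) ?_ (not_dvd_start hi hp _ _)))
    · ring
    · ring
  | @loop_succ i P σ σ' τ ρ e _ _ ih₁ ih₂ =>
    intro k hk
    have hk' := hk
    simp only [conts, List.cons_subset] at hk
    refine .head (step hk.1 (r := (π (.start (P :: loop i P :: k)),
      π (.start (loop i P :: k)) * π (.reg i))) (by simp [rulesOf]) ?_
      (not_dvd_start hi hp (P :: loop i P :: k) σ')) ((ih₁ _ hk.2).trans (ih₂ _ hk'))
    rw [e, enc_add_single]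
    ring

/-- The remaining computation at a place empties all counters. -/
def Clears : Place → (ℕ →₀ ℕ) → Prop
  | .reg _, _ => True
  | .start k, σ => ExecAll k σ 0
  | .exit k, σ => ExecAll k.tail σ 0

theorem clears_of_reaches (hi : Function.Injective π) (hp : ∀ a, (π a).Prime)
    {S : List (List CounterProg)} {x : ℕ}
    (h : ReflTransGen (DivStep (S.flatMap (rulesOf π)) (S.flatMap (forbOf π))) x
      (π (.start []))) : ∀ c σ, x = π c * enc π σ → Clears c σ := by
  induction h using ReflTransGen.head_induction_on with
  | refl =>
    intro c σ h
    obtain rfl : c = .start [] :=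
      hi ((Nat.prime_dvd_prime_iff_eq (hp _) (hp _)).1 (Dvd.intro _ h.symm))
    exact eq_zero_of_enc_eq_one hi hp ((Nat.mul_eq_left (hp _).ne_zero).1 h.symm)
  | @head x x' hstep _ ih =>
    rintro c σ rfl
    obtain ⟨⟨r, hr, hx⟩, hforb⟩ := hstep
    obtain ⟨s, hs, hr⟩ := List.mem_flatMap.1 hr
    have hpos (a : Place) : 0 < π a := (hp a).pos
    rcases s with _ | ⟨_ | i | ⟨P, Q⟩ | ⟨i, P⟩, k⟩
    · simp [rulesOf] at hr
    · obtain rfl := List.mem_singleton.1 hr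
      rcases dvd_mul_mul_enc hi hp (by simp) (Dvd.intro _ hx) with h | rfl
      · simp at h
      · have hx' : x' = π (.start k) * enc π σ :=
          Nat.eq_of_mul_eq_mul_left (hpos _) (hx.trans (by ring))
        exact ⟨σ, .skip σ, ih _ _ hx'⟩
    · obtain rfl := List.mem_singleton.1 hr
      have hx₁ : π (.start (inc i :: k)) * x' =
          π (.start k) * (π c * enc π (σ + single i 1)) := by
        rw [enc_add_single]
        exact hx.trans (by ring)
      rcases dvd_mul_mul_enc hi hp (by simp) (Dvd.intro _ hx₁) with h | rfl
      · simp at h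
      · have hx' : x' = π (.start k) * enc π (σ + single i 1) :=
          Nat.eq_of_mul_eq_mul_left (hpos _) (hx₁.trans (by ring))
        exact ⟨_, .inc i σ, ih _ _ hx'⟩
    · obtain rfl := List.mem_singleton.1 hr
      rcases dvd_mul_mul_enc hi hp (by simp) (Dvd.intro _ hx) with h | rfl
      · have := congrArg List.length (Place.start.inj h)
        simp at this
      · have hx' : x' = π (.start (P :: Q :: k)) * enc π σ :=
          Nat.eq_of_mul_eq_mul_left (hpos _) (hx.trans (by ring))
        obtain ⟨τ, h₁, ρ, h₂, h₃⟩ := ih _ _ hx'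
        exact ⟨ρ, .seq h₁ h₂, h₃⟩
    · simp only [rulesOf, List.mem_cons, List.not_mem_nil, or_false] at hr
      rcases hr with rfl | rfl | rfl
      · rcases dvd_mul_mul_enc hi hp (by simp)
          (Dvd.intro _ ((mul_assoc _ _ _).symm.trans hx)) with h | rfl
        · have := congrArg List.length (Place.start.inj h)
          simp at this
        · have hx₁ : π (.reg i) * x' = π (.start (P :: loop i P :: k)) * enc π σ :=
            Nat.eq_of_mul_eq_mul_left (hpos (.start (loop i P :: k)))
              (((mul_assoc _ _ _).symm.trans hx).trans (by ring))
          rcases dvd_mul_enc hi hp (Dvd.intro _ hx₁) with h | ⟨j, h, hσ⟩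
          · cases h
          · cases h
            obtain ⟨σ', rfl⟩ : ∃ σ', σ = σ' + single i 1 :=
              ⟨σ - single i 1, (tsub_add_cancel_of_le
                (single_le_iff.2 (Nat.one_le_iff_ne_zero.2 hσ))).symm⟩
            rw [enc_add_single] at hx₁
            have hx' : x' = π (.start (P :: loop i P :: k)) * enc π σ' :=
              Nat.eq_of_mul_eq_mul_left (hpos _) (hx₁.trans (by ring))
            obtain ⟨τ, h₁, ρ, h₂, h₃⟩ := ih _ _ hx'
            exact ⟨ρ, .loop_succ rfl h₁ h₂, h₃⟩
      · rcases dvd_mul_mul_enc hi hp (by simp) (Dvd.intro _ hx) with h | rfl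
        · cases h
        · have hx' : x' = π (.exit (loop i P :: k)) * enc π σ :=
            Nat.eq_of_mul_eq_mul_left (hpos _) (hx.trans (by ring))
          refine ⟨σ, .loop_zero ?_, ih _ _ hx'⟩
          by_contra hσ
          refine hforb _ (List.mem_flatMap.2 ⟨_, hs, List.mem_singleton_self _⟩) ?_
          rw [hx']
          exact mul_dvd_mul_left _ ((dvd_enc_iff hi hp _ _).2 ⟨i, rfl, hσ⟩)
      · rcases dvd_mul_mul_enc hi hp (by simp) (Dvd.intro _ hx) with h | rfl
        · cases h
        · have hx' : x' = π (.start k) * enc π σ :=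
            Nat.eq_of_mul_eq_mul_left (hpos _) (hx.trans (by ring))
          show ExecAll k σ 0
          exact ih (.start k) _ hx'

end Encoding

theorem exists_divStep_iff (P : CounterProg) :
    ∃ (rules : List (ℕ × ℕ)) (forb : List ℕ) (b p y : ℕ),
      (∀ r ∈ rules, 0 < r.1 ∧ 0 < r.2) ∧ (∀ f ∈ forb, 0 < f) ∧ 0 < b ∧ 0 < p ∧ 0 < y ∧
      (∀ n, ∀ f ∈ forb, ¬ f ∣ b * p ^ n) ∧
      ∀ n, ReflTransGen (DivStep rules forb) (b * p ^ n) y ↔ Exec P (single 0 n) 0 := by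
  obtain ⟨π, hi, hp⟩ := exists_injective_prime
  have hpos (a : Place) : 0 < π a := (hp a).pos
  have henc (n : ℕ) : π (.reg 0) ^ n = enc π (single 0 n) := by
    simp [enc]
  refine ⟨(conts P []).flatMap (rulesOf π), (conts P []).flatMap (forbOf π), π (.start [P]),
    π (.reg 0), π (.start []), ?_, ?_, hpos _, hpos _, hpos _, ?_, ?_⟩
  · intro r hr
    obtain ⟨s, -, hr⟩ := List.mem_flatMap.1 hr
    rcases s with _ | ⟨_ | _ | _ | _, k⟩ <;> simp [rulesOf] at hr
    · simp [hr, hpos]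
    · simp [hr, hpos]
    · simp [hr, hpos]
    · rcases hr with rfl | rfl | rfl <;> simp [hpos]
  · intro f hf
    obtain ⟨s, -, hf⟩ := List.mem_flatMap.1 hf
    obtain ⟨i, P, k, -, rfl⟩ := mem_forbOf hf
    exact mul_pos (hpos _) (hpos _)
  · intro n
    rw [henc]
    exact not_dvd_start hi hp _ _
  · intro n
    rw [henc]
    constructor
    · intro h
      obtain ⟨ρ, h, rfl⟩ : ExecAll [P] (single 0 n) 0 :=
        clears_of_reaches hi hp h (.start [P]) _ rfl
      exact h
    · intro h
      simpa [enc] using h.reaches hi hp [] (List.Subset.refl _)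

end CounterProg

open scoped Matrix

/-! ### Matrix games -/

section Game

variable {U V : Set MGMat} {x₀ y : MGVec}

/-- Positions from which Eve can force the target `y` in boundedly many rounds along each play. -/
inductive EveWinsFrom (U V : Set MGMat) (y : MGVec) : MGVec → Prop
  | intro (v : MGVec) (N : MGMat → MGMat) : (∀ M ∈ V, N M ∈ U) →
      (∀ M ∈ V, (v ᵥ* M) ᵥ* N M ≠ y → EveWinsFrom U V y ((v ᵥ* M) ᵥ* N M)) → EveWinsFrom U V y v

theorem EveWinsFrom.of_forall_exists {v : MGVec}
    (h : ∀ M ∈ V, ∃ N ∈ U, (v ᵥ* M) ᵥ* N = y ∨ EveWinsFrom U V y ((v ᵥ* M) ᵥ* N)) :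
    EveWinsFrom U V y v := by
  choose! N hU hN using h
  exact .intro v N hU fun M hM hne => (hN M hM).resolve_left hne

theorem mgPlay_succ_eq_cons (σ : MGEStrat) (τ : MGAStrat) (k : ℕ) :
    mgPlay σ τ (k + 1) = (τ [], σ [] (τ [])) ::
      mgPlay (fun h => σ ((τ [], σ [] (τ [])) :: h)) (fun h => τ ((τ [], σ [] (τ [])) :: h)) k := by
  induction k with
  | zero => rfl
  | succ k ih =>
    rw [mgPlay, ih]
    rfl

theorem EveWinsFrom.mgEveWins (h : EveWinsFrom U V y x₀) : MGEveWins U V x₀ y := by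
  induction h with
  | intro v N hU _ ih =>
    choose! S hS using ih
    let σ : MGEStrat := fun h M =>
      match h with
      | [] => N M
      | p :: h => S p.1 h M
    refine ⟨σ, fun τ hτ => ?_⟩
    set M := τ [] with hM
    have hMV : M ∈ V := hτ 0
    have hplay (k : ℕ) : mgPlay σ τ (k + 1) =
        (M, N M) :: mgPlay (S M) (fun h => τ ((M, N M) :: h)) k :=
      mgPlay_succ_eq_cons σ τ k
    by_cases hy : (v ᵥ* M) ᵥ* N M = y
    · refine ⟨0, fun j hj => ?_, hy⟩
      obtain rfl : j = 0 := by omega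
      exact hU M hMV
    · obtain ⟨k, hk, hky⟩ := hS M hMV hy (fun h => τ ((M, N M) :: h)) fun k => by
        rw [← hplay]
        exact hτ (k + 1)
      refine ⟨k + 1, fun j hj => ?_, ?_⟩
      · cases j with
        | zero => exact hU M hMV
        | succ j =>
          rw [hplay]
          exact hk j (by omega)
      · rw [hplay]
        exact hky

theorem not_mgEveWins (I : MGVec → Prop) (h₀ : I x₀)
    (h : ∀ v, I v → ∃ M ∈ V, ∀ N ∈ U, (v ᵥ* M) ᵥ* N ≠ y ∧ I ((v ᵥ* M) ᵥ* N)) :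
    ¬ MGEveWins U V x₀ y := by
  classical
  rintro ⟨σ, hσ⟩
  obtain ⟨M₀, hM₀, -⟩ := h x₀ h₀
  choose! m hm hm' using h
  obtain ⟨k, hk, hky⟩ := hσ (fun h => if I (mgVecAfter x₀ h) then m (mgVecAfter x₀ h) else M₀) <| by
    intro k
    split_ifs with hI
    · exact hm _ hI
    · exact hM₀
  set τ : MGAStrat := fun h => if I (mgVecAfter x₀ h) then m (mgVecAfter x₀ h) else M₀ with hτ
  have hsucc (j : ℕ) : mgVecAfter x₀ (mgPlay σ τ (j + 1)) =
      (mgVecAfter x₀ (mgPlay σ τ j) ᵥ* τ (mgPlay σ τ j)) ᵥ*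
        σ (mgPlay σ τ j) (τ (mgPlay σ τ j)) := by
    simp [mgPlay, mgVecAfter]
  have hinv : ∀ j ≤ k, I (mgVecAfter x₀ (mgPlay σ τ j)) := by
    intro j hj
    induction j with
    | zero => exact h₀
    | succ j ih =>
      have hI := ih (by omega)
      have hτj : τ (mgPlay σ τ j) = m (mgVecAfter x₀ (mgPlay σ τ j)) := if_pos hI
      have hU := hk j (by omega)
      rw [hsucc]
      rw [hτj] at hU ⊢
      exact (hm' _ hI _ hU).2
  have hI := hinv k le_rfl
  have hτk : τ (mgPlay σ τ k) = m (mgVecAfter x₀ (mgPlay σ τ k)) := if_pos hI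
  have hU := hk k le_rfl
  rw [hsucc] at hky
  rw [hτk] at hU hky
  exact (hm' _ hI _ hU).1 hky

end Game

section DivStepGame

theorem vecMul_toMat (a b c p₁ p₂ p₃ q₁ q₂ q₃ r₁ r₂ r₃ : ℤ) :
    ![a, b, c] ᵥ* toMat ((p₁, p₂, p₃), (q₁, q₂, q₃), (r₁, r₂, r₃)) =
      ![a * p₁ + b * q₁ + c * r₁, a * p₂ + b * q₂ + c * r₂, a * p₃ + b * q₃ + c * r₃] := by
  ext i
  fin_cases i <;> simp [toMat, toVec, Matrix.vecMul, dotProduct, Fin.sum_univ_three]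

/-- Eve's move applying the fraction `r.1 / r.2`. -/
def ruleMove (r : ℕ × ℕ) : M3 := ((r.1, 0, 0), (0, r.2, 0), (0, 0, r.1))

/-- Eve's move lowering the first coordinate by `w` times the third one. -/
def lowerMove (w : ℕ) : M3 := ((1, 0, 0), (0, 0, 0), (-w, 0, 1))

/-- Eve's move claiming that the first coordinate is `r` times the third one. -/
def remainderMove (r : ℕ) : M3 := ((1, 0, 0), (0, 0, 0), (-r, 0, 0))

/-- Eve's move claiming that the first coordinate is `z` times the second one. -/
def finalMove (z : ℕ) : M3 := ((1, 0, 0), (-z, 0, 0), (0, 0, 1))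

/-- Adam's idle move. -/
def idleMove : M3 := ((1, 0, 0), (0, 1, 0), (0, 0, 1))

/-- Adam's move challenging Eve to show that the quotient of the first coordinate by the second
one is an integer without forbidden divisors. -/
def challengeMove : M3 := ((1, 0, 0), (0, 0, 1), (0, 0, 1))

/-- Eve's moves in the game simulating `DivStep rules forb` with target `z`. -/
def eveMoves (rules : List (ℕ × ℕ)) (forb : List ℕ) (z : ℕ) : List M3 :=
  rules.map ruleMove ++ lowerMove forb.prod :: finalMove z ::
    ((List.range forb.prod).filter fun r => ∀ f ∈ forb, ¬ f ∣ r).map remainderMove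

/-- Adam's moves in the game simulating `DivStep`. -/
def adamMoves : List M3 := [idleMove, challengeMove]

variable {rules : List (ℕ × ℕ)} {forb : List ℕ} {z : ℕ}

theorem mem_eveMoves {t : M3} : t ∈ eveMoves rules forb z ↔
    (∃ r ∈ rules, t = ruleMove r) ∨ t = lowerMove forb.prod ∨ t = finalMove z ∨
      ∃ r < forb.prod, (∀ f ∈ forb, ¬ f ∣ r) ∧ t = remainderMove r := by
  simp [eveMoves, eq_comm, and_assoc]

theorem vecMul_ruleMove (a b c : ℤ) (r : ℕ × ℕ) :
    ![a, b, c] ᵥ* toMat (ruleMove r) = ![a * r.1, b * r.2, c * r.1] := by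
  simp [ruleMove, vecMul_toMat]

theorem vecMul_lowerMove (a b c : ℤ) (w : ℕ) :
    ![a, b, c] ᵥ* toMat (lowerMove w) = ![a - c * w, 0, c] := by
  simp [lowerMove, vecMul_toMat, sub_eq_add_neg]

theorem vecMul_remainderMove (a b c : ℤ) (r : ℕ) :
    ![a, b, c] ᵥ* toMat (remainderMove r) = ![a - c * r, 0, 0] := by
  simp [remainderMove, vecMul_toMat, sub_eq_add_neg]

theorem vecMul_finalMove (a b c : ℤ) (z : ℕ) :
    ![a, b, c] ᵥ* toMat (finalMove z) = ![a - b * z, 0, c] := by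
  simp [finalMove, vecMul_toMat, sub_eq_add_neg]

theorem vecMul_idleMove (a b c : ℤ) : ![a, b, c] ᵥ* toMat idleMove = ![a, b, c] := by
  simp [idleMove, vecMul_toMat]

theorem vecMul_challengeMove (a b c : ℤ) :
    ![a, b, c] ᵥ* toMat challengeMove = ![a, 0, b + c] := by
  simp [challengeMove, vecMul_toMat]

theorem EveWinsFrom.of_list {E A : List M3} {y v : MGVec}
    (h : ∀ s ∈ A, ∃ t ∈ E, (v ᵥ* toMat s) ᵥ* toMat t = y ∨
      EveWinsFrom {M | ∃ r ∈ E, M = toMat r} {M | ∃ r ∈ A, M = toMat r} y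
        ((v ᵥ* toMat s) ᵥ* toMat t)) :
    EveWinsFrom {M | ∃ r ∈ E, M = toMat r} {M | ∃ r ∈ A, M = toMat r} y v := by
  refine .of_forall_exists ?_
  rintro _ ⟨s, hs, rfl⟩
  obtain ⟨t, ht, h⟩ := h s hs
  exact ⟨_, ⟨t, ht, rfl⟩, h⟩

/-- Eve answers a challenge by exhibiting the quotient and its remainder modulo the product of
the forbidden divisors. -/
theorem exists_answer {r : ℕ} (hr : r < forb.prod) (hrf : ∀ f ∈ forb, ¬ f ∣ r) (c : ℤ) (n : ℕ) :
    ∃ t ∈ eveMoves rules forb z,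
      ![((forb.prod * n + r : ℕ) : ℤ) * c, 0, c] ᵥ* toMat t = ![0, 0, 0] ∨
      EveWinsFrom {M | ∃ r ∈ eveMoves rules forb z, M = toMat r}
        {M | ∃ r ∈ adamMoves, M = toMat r} ![0, 0, 0]
        (![((forb.prod * n + r : ℕ) : ℤ) * c, 0, c] ᵥ* toMat t) := by
  induction n with
  | zero =>
    refine ⟨_, mem_eveMoves.2 (.inr (.inr (.inr ⟨r, hr, hrf, rfl⟩))), .inl ?_⟩
    rw [vecMul_remainderMove]
    congr 1
    push_cast
    ring
  | succ n ih =>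
    refine ⟨_, mem_eveMoves.2 (.inr (.inl rfl)), .inr ?_⟩
    have h : ![((forb.prod * (n + 1) + r : ℕ) : ℤ) * c, 0, c] ᵥ* toMat (lowerMove forb.prod) =
        ![((forb.prod * n + r : ℕ) : ℤ) * c, 0, c] := by
      rw [vecMul_lowerMove]
      congr 1
      push_cast
      ring
    rw [h]
    refine .of_list fun s hs => ?_
    simp only [adamMoves, List.mem_cons, List.not_mem_nil, or_false] at hs
    rcases hs with rfl | rfl
    · rwa [vecMul_idleMove]
    · rwa [vecMul_challengeMove, zero_add]

theorem eveWinsFrom_of_reaches (hforb : ∀ f ∈ forb, 0 < f) {x : ℕ}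
    (h : Relation.ReflTransGen (DivStep rules forb) x z) (hx : ∀ f ∈ forb, ¬ f ∣ x) (c : ℤ) :
    EveWinsFrom {M | ∃ r ∈ eveMoves rules forb z, M = toMat r}
      {M | ∃ r ∈ adamMoves, M = toMat r} ![0, 0, 0] ![x * c, c, 0] := by
  have challenge {x : ℕ} (hx : ∀ f ∈ forb, ¬ f ∣ x) (c : ℤ) :
      ∃ t ∈ eveMoves rules forb z, ![(x : ℤ) * c, 0, c] ᵥ* toMat t = ![0, 0, 0] ∨
      EveWinsFrom {M | ∃ r ∈ eveMoves rules forb z, M = toMat r}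
        {M | ∃ r ∈ adamMoves, M = toMat r} ![0, 0, 0] (![(x : ℤ) * c, 0, c] ᵥ* toMat t) := by
    have hpos : 0 < forb.prod := List.prod_pos hforb
    have key := exists_answer (rules := rules) (z := z) (Nat.mod_lt x hpos) (fun f hf h => hx f hf
      ((Nat.dvd_mod_iff (List.dvd_prod hf)).1 h)) c (x / forb.prod)
    rwa [Nat.div_add_mod] at key
  induction h using Relation.ReflTransGen.head_induction_on generalizing c with
  | refl =>
    refine .of_list fun s hs => ?_
    simp only [adamMoves, List.mem_cons, List.not_mem_nil, or_false] at hs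
    rcases hs with rfl | rfl
    · rw [vecMul_idleMove]
      refine ⟨_, mem_eveMoves.2 (.inr (.inr (.inl rfl))), .inl ?_⟩
      rw [vecMul_finalMove]
      congr 1
      ring
    · rw [vecMul_challengeMove, add_zero]
      exact challenge hx c
  | @head x x' hstep _ ih =>
    obtain ⟨⟨r, hr, hrx⟩, hx'⟩ := hstep
    refine .of_list fun s hs => ?_
    simp only [adamMoves, List.mem_cons, List.not_mem_nil, or_false] at hs
    rcases hs with rfl | rfl
    · rw [vecMul_idleMove]
      refine ⟨_, mem_eveMoves.2 (.inl ⟨r, hr, rfl⟩), .inr ?_⟩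
      have h : ![(x : ℤ) * c, c, 0] ᵥ* toMat (ruleMove r) = ![x' * (c * r.2), c * r.2, 0] := by
        have hrx' : (r.2 : ℤ) * x' = r.1 * x := mod_cast hrx
        rw [vecMul_ruleMove, zero_mul]
        congr 1
        linear_combination (-c) * hrx'
      rw [h]
      exact ih hx' _
    · rw [vecMul_challengeMove, add_zero]
      exact challenge hx c

/-- The positions from which Adam prevents Eve from reaching the zero vector. -/
inductive AdamSafe (rules : List (ℕ × ℕ)) (forb : List ℕ) (z : ℕ) : MGVec → Prop
  | dead (d : ℤ) : d ≠ 0 → AdamSafe rules forb z ![d, 0, 0]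
  | caught (a c : ℤ) : 0 < c → (∀ x : ℤ, (∀ f ∈ forb, ¬ (f : ℤ) ∣ x) → a ≠ x * c) →
      AdamSafe rules forb z ![a, 0, c]
  | stuck (x : ℕ) (c : ℤ) : 0 < c → 0 < x → ¬ Relation.ReflTransGen (DivStep rules forb) x z →
      AdamSafe rules forb z ![x * c, c, 0]
  | cheat (a c : ℤ) : 0 < a → 0 < c → (∀ x : ℤ, (∀ f ∈ forb, ¬ (f : ℤ) ∣ x) → a ≠ x * c) →
      AdamSafe rules forb z ![a, c, 0]

theorem AdamSafe.ne_zero {v : MGVec} (h : AdamSafe rules forb z v) : v ≠ ![0, 0, 0] := by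
  intro hv
  rcases h with ⟨d, hd⟩ | ⟨a, c, hc, -⟩ | ⟨x, c, hc, -⟩ | ⟨a, c, -, hc, -⟩
  · exact hd (congrFun hv 0)
  · exact hc.ne' (congrFun hv 2)
  · exact hc.ne' (congrFun hv 1)
  · exact hc.ne' (congrFun hv 1)

theorem adamSafe_vecMul_of_caught (hrules : ∀ r ∈ rules, 0 < r.1 ∧ 0 < r.2) {a c : ℤ} (hc : 0 < c)
    (h : ∀ x : ℤ, (∀ f ∈ forb, ¬ (f : ℤ) ∣ x) → a ≠ x * c) {t : M3}
    (ht : t ∈ eveMoves rules forb z) : AdamSafe rules forb z (![a, 0, c] ᵥ* toMat t) := by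
  obtain ⟨r, hr, rfl⟩ | rfl | rfl | ⟨r, -, hr, rfl⟩ := mem_eveMoves.1 ht
  · have hr₁ : (0 : ℤ) < r.1 := mod_cast (hrules r hr).1
    rw [vecMul_ruleMove, zero_mul]
    refine .caught _ _ (by positivity) fun x hx hax => h x hx ?_
    exact mul_right_cancel₀ hr₁.ne' (by linear_combination hax)
  · rw [vecMul_lowerMove]
    refine .caught _ _ hc fun x hx hax => h (x + forb.prod) (fun f hf hfx => hx f hf ?_) ?_
    · exact (dvd_add_left (Int.natCast_dvd_natCast.2 (List.dvd_prod hf))).1 hfx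
    · linear_combination hax
  · rw [vecMul_finalMove, zero_mul, sub_zero]
    exact .caught _ _ hc h
  · rw [vecMul_remainderMove]
    refine .dead _ (sub_ne_zero.2 ?_)
    rw [mul_comm]
    exact h r fun f hf hfr => hr f hf (Int.natCast_dvd_natCast.1 hfr)

theorem AdamSafe.exists_move (hrules : ∀ r ∈ rules, 0 < r.1 ∧ 0 < r.2) {v : MGVec}
    (h : AdamSafe rules forb z v) :
    ∃ s ∈ adamMoves, ∀ t ∈ eveMoves rules forb z,
      AdamSafe rules forb z ((v ᵥ* toMat s) ᵥ* toMat t) := by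
  have idle : idleMove ∈ adamMoves := by simp [adamMoves]
  rcases h with ⟨d, hd⟩ | ⟨a, c, hc, h⟩ | ⟨x, c, hc, hx, h⟩ | ⟨a, c, -, hc, h⟩
  · refine ⟨idleMove, idle, fun t ht => ?_⟩
    rw [vecMul_idleMove]
    obtain ⟨r, hr, rfl⟩ | rfl | rfl | ⟨r, -, hr, rfl⟩ := mem_eveMoves.1 ht
    · rw [vecMul_ruleMove, zero_mul, zero_mul]
      exact .dead _ (mul_ne_zero hd (mod_cast (hrules r hr).1.ne'))
    · rw [vecMul_lowerMove, zero_mul, sub_zero]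
      exact .dead _ hd
    · rw [vecMul_finalMove, zero_mul, sub_zero]
      exact .dead _ hd
    · rw [vecMul_remainderMove, zero_mul, sub_zero]
      exact .dead _ hd
  · refine ⟨idleMove, idle, fun t ht => ?_⟩
    rw [vecMul_idleMove]
    exact adamSafe_vecMul_of_caught hrules hc h ht
  · refine ⟨idleMove, idle, fun t ht => ?_⟩
    have hxc : (0 : ℤ) < x * c := by positivity
    rw [vecMul_idleMove]
    obtain ⟨r, hr, rfl⟩ | rfl | rfl | ⟨r, -, hr, rfl⟩ := mem_eveMoves.1 ht
    · have hr₁ : (0 : ℤ) < r.1 := mod_cast (hrules r hr).1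
      have hr₂ : (0 : ℤ) < r.2 := mod_cast (hrules r hr).2
      rw [vecMul_ruleMove, zero_mul]
      by_cases hx' : ∃ x' : ℤ, (∀ f ∈ forb, ¬ (f : ℤ) ∣ x') ∧ x * c * r.1 = x' * (c * r.2)
      · obtain ⟨x', hx'f, hx'⟩ := hx'
        have hpos : 0 < x' := by
          have : 0 < x' * (c * r.2) := hx' ▸ mul_pos hxc hr₁
          exact (mul_pos_iff_of_pos_right (by positivity)).1 this
        lift x' to ℕ using hpos.le
        rw [hx']
        refine .stuck _ _ (by positivity) (mod_cast hpos) fun hpath => h (.head ⟨⟨r, hr, ?_⟩, ?_⟩ hpath)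
        · have : (r.2 : ℤ) * x' = r.1 * x :=
            mul_left_cancel₀ hc.ne' (by linear_combination -hx')
          exact mod_cast this
        · exact fun f hf hfx => hx'f f hf (Int.natCast_dvd_natCast.2 hfx)
      · push Not at hx'
        exact .cheat _ _ (by positivity) (by positivity) hx'
    · rw [vecMul_lowerMove, zero_mul, sub_zero]
      exact .dead _ hxc.ne'
    · rw [vecMul_finalMove]
      refine .dead _ fun h0 => h ?_
      have : (x : ℤ) = z := mul_left_cancel₀ hc.ne' (by linear_combination h0)
      rw [Int.natCast_inj.1 this]
    · rw [vecMul_remainderMove, zero_mul, sub_zero]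
      exact .dead _ hxc.ne'
  · refine ⟨challengeMove, by simp [adamMoves], fun t ht => ?_⟩
    rw [vecMul_challengeMove, add_zero]
    exact adamSafe_vecMul_of_caught hrules hc h ht

theorem mgEveWins_iff_reaches (hrules : ∀ r ∈ rules, 0 < r.1 ∧ 0 < r.2) (hforb : ∀ f ∈ forb, 0 < f)
    {x : ℕ} (hx : 0 < x) (hxf : ∀ f ∈ forb, ¬ f ∣ x) :
    MGEveWins {M | ∃ r ∈ eveMoves rules forb z, M = toMat r} {M | ∃ r ∈ adamMoves, M = toMat r}
      (toVec (x, 1, 0)) (toVec (0, 0, 0)) ↔ Relation.ReflTransGen (DivStep rules forb) x z := by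
  constructor
  · intro hwin
    by_contra h
    refine not_mgEveWins (AdamSafe rules forb z) ?_ (fun v hv => ?_) hwin
    · have := AdamSafe.stuck x 1 one_pos hx h
      rwa [mul_one] at this
    · obtain ⟨s, hs, h⟩ := hv.exists_move hrules
      refine ⟨_, ⟨s, hs, rfl⟩, ?_⟩
      rintro _ ⟨t, ht, rfl⟩
      exact ⟨(h t ht).ne_zero, h t ht⟩
  · intro h
    have := (eveWinsFrom_of_reaches hforb h hxf 1).mgEveWins
    rwa [mul_one] at this

end DivStepGame

/-! ### Computability -/

theorem primrec_int_natCast : Primrec fun n : ℕ => (n : ℤ) := by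
  refine Primrec.encode_iff.1 ?_
  refine (Primrec.nat_mul.comp (Primrec.const 2) Primrec.id).of_eq fun n => ?_
  rfl

theorem primrec_const_mul_pow (b p : ℕ) : Primrec fun n => b * p ^ n := by
  refine Primrec.nat_mul.comp (Primrec.const b) ?_
  refine (Primrec.nat_rec₁ 1 (Primrec.nat_mul.comp₂ Primrec₂.right (Primrec₂.const p))).of_eq
    fun n => ?_
  induction n with
  | zero => rfl
  | succ n ih => rw [pow_succ, ← ih]

/-- The halting problem as the existence of a zero of a primitive recursive function. -/
theorem exists_primrec_dom_iff : ∃ g : ℕ → ℕ → ℕ, Primrec₂ g ∧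
    ∀ c : Nat.Partrec.Code, (c.eval 0).Dom ↔ ∃ k, g k (Encodable.encode c) = 0 := by
  refine ⟨fun k n => bif ((Denumerable.ofNat Nat.Partrec.Code n).evaln k 0).isSome then 0 else 1,
    ?_, fun c => ?_⟩
  · refine Primrec.cond (Primrec.option_isSome.comp ?_) (Primrec.const 0) (Primrec.const 1)
    exact Nat.Partrec.Code.primrec_evaln.comp
      (Primrec.pair (Primrec.pair Primrec.fst ((Primrec.ofNat _).comp Primrec.snd))
        (Primrec.const 0))
  · rw [Part.dom_iff_mem]
    simp only [Nat.Partrec.Code.evaln_complete, Denumerable.ofNat_encode]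
    constructor
    · rintro ⟨x, k, h⟩
      exact ⟨k, by simp [Option.mem_def.1 h]⟩
    · rintro ⟨k, h⟩
      cases hx : Nat.Partrec.Code.evaln k c 0 with
      | none => simp [hx] at h
      | some x => exact ⟨x, k, hx⟩

/-- It is undecidable whether Eve has a winning strategy to
reach the target vector from the initial row vector in a three-dimensional
matrix game. -/
theorem undecidable_matrix_game :
    ¬ ∃ f : MGData → Bool, Computable f ∧
      ∀ d : MGData,
        (f d = true ↔
          MGEveWins { M | ∃ r ∈ d.1, M = toMat r } { M | ∃ r ∈ d.2.1, M = toMat r }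
            (toVec d.2.2.1) (toVec d.2.2.2)) := by
  rintro ⟨f, hf, hfd⟩
  obtain ⟨g, hg, hgc⟩ := exists_primrec_dom_iff
  obtain ⟨P, hP⟩ := CounterProg.exists_exec_iff_of_primrec hg
  obtain ⟨rules, forb, b, p, z, hrules, hforb, hb, hp, -, hn, hreach⟩ := P.exists_divStep_iff
  refine ComputablePred.halting_problem 0 (ComputablePred.computable_iff.2
    ⟨fun c => f (eveMoves rules forb z, adamMoves, (((b * p ^ Encodable.encode c : ℕ) : ℤ), 1, 0),
      (0, 0, 0)), hf.comp ?_, ?_⟩)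
  · refine Primrec.to_comp (Primrec.pair (Primrec.const _) (Primrec.pair (Primrec.const _)
      (Primrec.pair (Primrec.pair ?_ (Primrec.const _)) (Primrec.const _))))
    exact primrec_int_natCast.comp ((primrec_const_mul_pow b p).comp Primrec.encode)
  · funext c
    rw [hgc, ← hP, ← hreach, hfd,
      mgEveWins_iff_reaches hrules hforb (mul_pos hb (pow_pos hp _)) (hn _)]
end
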